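/- Let ρ, σ be pure density operators on H^{⊗k} ⊗ K whose marginals on the i-th copy of H satisfy Tr(ρᵢσᵢ) ≥ 1 − εᵢ. Set ε = (1/k)Σᵢεᵢ. Then there exist fully separable pure states ρ̃ = |ψ₁⟩⟨ψ₁|⊗⋯⊗|ψ_k⟩⟨ψ_k|⊗|ψ'⟩⟨ψ'| and σ̃ = |φ₁⟩⟨φ₁|⊗⋯⊗|φ_k⟩⟨φ_k|⊗|φ'⟩⟨φ'| such that ‖ρ−ρ̃‖₂ ≤ 2√(kε), ‖σ−σ̃‖₂ ≤ 2√(kε), and ‖Tr_K ρ̃ − Tr_K σ̃‖₂ ≤ 6√(kε). -/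

import Mathlib

open Matrix BigOperators

/-- The outer product `|ψ⟩⟨ψ|`. -/
noncomputable def outer {ι : Type*} [Fintype ι] (ψ : ι → ℂ) : Matrix ι ι ℂ :=
  Matrix.vecMulVec ψ (star ψ)

/-- The Frobenius (Hilbert–Schmidt) norm `‖A‖₂ = √(Tr(A†A))`. -/
noncomputable def frobNorm {ι : Type*} [Fintype ι] (A : Matrix ι ι ℂ) : ℝ :=
  Real.sqrt ((Aᴴ * A).trace.re)

/-- The marginal (partial trace) of an operator on `H^{⊗k} ⊗ K` onto the `i`-th copy of `H`,
where `H = ℂ^d` and `K = ℂ^m`. -/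
noncomputable def marginalM {k d m : ℕ}
    (ρ : Matrix ((Fin k → Fin d) × Fin m) ((Fin k → Fin d) × Fin m) ℂ) (i : Fin k) :
    Matrix (Fin d) (Fin d) ℂ :=
  Matrix.of fun a b => ∑ f : Fin k → Fin d, ∑ y : Fin m,
    if f i = a then ρ (f, y) (Function.update f i b, y) else 0

/-- The product vector `|χ₁⟩ ⊗ ⋯ ⊗ |χ_k⟩ ⊗ |ψ'⟩` in `H^{⊗k} ⊗ K`. -/
noncomputable def prodVec {k d m : ℕ} (χ : Fin k → Fin d → ℂ) (ψ' : Fin m → ℂ) :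
    ((Fin k → Fin d) × Fin m) → ℂ :=
  fun fy => (∏ i, χ i (fy.1 i)) * ψ' fy.2

/-- The partial trace over the `K` factor of an operator on `H^{⊗k} ⊗ K`. -/
noncomputable def trK {k d m : ℕ}
    (ρ : Matrix ((Fin k → Fin d) × Fin m) ((Fin k → Fin d) × Fin m) ℂ) :
    Matrix (Fin k → Fin d) (Fin k → Fin d) ℂ :=
  Matrix.of fun f g => ∑ y : Fin m, ρ (f, y) (g, y)

abbrev toE {ι : Type*} (x : ι → ℂ) : EuclideanSpace ℂ ι := WithLp.toLp 2 x

lemma inner_toE {ι : Type*} [Fintype ι] (x y : ι → ℂ) :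
    inner ℂ (toE x) (toE y) = ∑ i, star (x i) * y i := by
  simp [PiLp.inner_apply, mul_comm]

lemma norm_toE_sq {ι : Type*} [Fintype ι] (x : ι → ℂ) :
    ‖toE x‖ ^ 2 = ∑ i, ‖x i‖ ^ 2 := by
  simp [EuclideanSpace.norm_sq_eq]

lemma unit_iff {ι : Type*} [Fintype ι] (x : ι → ℂ) :
    star x ⬝ᵥ x = 1 ↔ ‖toE x‖ = 1 := by
  have h : star x ⬝ᵥ x = ((‖toE x‖ ^ 2 : ℝ) : ℂ) := by
    have := inner_self_eq_norm_sq_to_K (𝕜 := ℂ) (toE x)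
    rw [inner_toE] at this
    simpa [dotProduct] using this
  rw [h]
  constructor
  · intro h
    have h1 : ‖toE x‖ ^ 2 = 1 := by exact_mod_cast h
    have := norm_nonneg (toE x)
    nlinarith
  · intro h
    simp [h]

/-- A matrix as a Euclidean vector. -/
def vecM {ι : Type*} (A : Matrix ι ι ℂ) : EuclideanSpace ℂ (ι × ι) := toE fun p => A p.1 p.2

lemma vecM_sub {ι : Type*} (A B : Matrix ι ι ℂ) : vecM (A - B) = vecM A - vecM B := rfl

lemma inner_vecM {ι : Type*} [Fintype ι] (A B : Matrix ι ι ℂ) :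
    inner ℂ (vecM A) (vecM B) = ∑ i, ∑ j, star (A i j) * B i j := by
  rw [vecM, vecM, inner_toE, Fintype.sum_prod_type]

lemma frobNorm_eq {ι : Type*} [Fintype ι] (A : Matrix ι ι ℂ) : frobNorm A = ‖vecM A‖ := by
  have h : (Aᴴ * A).trace = inner ℂ (vecM A) (vecM A) := by
    rw [inner_vecM, Finset.sum_comm]
    simp [Matrix.trace, Matrix.mul_apply]
  rw [frobNorm, h, inner_self_eq_norm_sq_to_K]
  norm_cast
  exact Real.sqrt_sq (norm_nonneg (vecM A))

lemma inner_outer {ι : Type*} [Fintype ι] (x y : ι → ℂ) :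
    inner ℂ (vecM (outer x)) (vecM (outer y)) = ((‖inner ℂ (toE x) (toE y)‖ ^ 2 : ℝ) : ℂ) := by
  have : ((‖inner ℂ (toE x) (toE y)‖ ^ 2 : ℝ) : ℂ)
      = inner ℂ (toE x) (toE y) * star (inner ℂ (toE x) (toE y)) := by
    push_cast
    exact (Complex.mul_conj' _).symm
  rw [this, inner_vecM, inner_toE, star_sum, Finset.sum_mul_sum]
  refine Finset.sum_congr rfl fun i _ => Finset.sum_congr rfl fun j _ => ?_
  simp [outer, Matrix.vecMulVec_apply]
  ring

lemma norm_vecM_outer {ι : Type*} [Fintype ι] (z : ι → ℂ) (hz : ‖toE z‖ = 1) :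
    ‖vecM (outer z)‖ ^ 2 = 1 := by
  have h1 := inner_outer z z
  rw [inner_self_eq_norm_sq_to_K, inner_self_eq_norm_sq_to_K, hz] at h1
  have h2 : ((‖vecM (outer z)‖ ^ 2 : ℝ) : ℂ) = ((1 : ℝ) : ℂ) := by
    push_cast
    exact h1.trans (by norm_num)
  exact Complex.ofReal_injective h2

lemma frob_outer_sub {ι : Type*} [Fintype ι] (x y : ι → ℂ) (hx : ‖toE x‖ = 1)
    (hy : ‖toE y‖ = 1) :
    frobNorm (outer x - outer y) ^ 2 = 2 * (1 - ‖inner ℂ (toE x) (toE y)‖ ^ 2) := by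
  rw [frobNorm_eq, vecM_sub, @norm_sub_sq ℂ, norm_vecM_outer x hx, norm_vecM_outer y hy, inner_outer]
  simp only [RCLike.re_to_complex, Complex.ofReal_re]
  ring

/-- Union bound for commuting projections. -/
lemma union_bound {E : Type*} [NormedAddCommGroup E] [InnerProductSpace ℂ E] {ι : Type*}
    [DecidableEq ι]
    (Q : ι → E →ₗ[ℂ] E) (hs : ∀ i, (Q i).IsSymmetric) (hid : ∀ i x, Q i (Q i x) = Q i x)
    (hc : ∀ i j x, Q i (Q j x) = Q j (Q i x)) (ψ : E) (hψ : ‖ψ‖ = 1) (ε : ι → ℝ)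
    (h : ∀ i, 1 - ε i ≤ ‖Q i ψ‖ ^ 2) (S : Finset ι) :
    ∃ T : E →ₗ[ℂ] E, T.IsSymmetric ∧ (∀ x, T (T x) = T x) ∧ (∀ i x, T (Q i x) = Q i (T x)) ∧
      (∀ i ∈ S, ∀ x, Q i (T x) = T x) ∧ 1 - ∑ i ∈ S, ε i ≤ ‖T ψ‖ ^ 2 := by
  have pyth : ∀ (T : E →ₗ[ℂ] E), T.IsSymmetric → (∀ x, T (T x) = T x) → ∀ x,
      ‖x‖ ^ 2 = ‖T x‖ ^ 2 + ‖x - T x‖ ^ 2 := by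
    intro T h1 h2 x
    have : inner ℂ (T x) (x - T x) = 0 := by
      rw [inner_sub_right, h1 x (T x), h2, ← h1 x x, sub_self]
    have h3 := norm_add_sq_eq_norm_sq_add_norm_sq_of_inner_eq_zero _ _ this
    rw [add_sub_cancel] at h3
    nlinarith
  induction S using Finset.induction_on with
  | empty => exact ⟨LinearMap.id, fun x y => rfl, fun x => rfl, fun i x => rfl, by simp, by simp [hψ]⟩
  | insert j S hj ih =>
    obtain ⟨T, h1, h2, h3, h4, h5⟩ := ih
    refine ⟨Q j ∘ₗ T, ?_, ?_, ?_, ?_, ?_⟩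
    · intro x y
      simp only [LinearMap.comp_apply]
      rw [hs j, h1, h3]
    · intro x
      simp only [LinearMap.comp_apply]
      rw [h3, hid, h2]
    · intro i x
      simp only [LinearMap.comp_apply]
      rw [h3, hc]
    · intro i hi x
      simp only [LinearMap.comp_apply]
      rcases Finset.mem_insert.1 hi with rfl | hi
      · rw [hid]
      · rw [hc, h4 i hi]
    · rw [Finset.sum_insert hj]
      simp only [LinearMap.comp_apply]
      have e1 := pyth (Q j) (hs j) (hid j) (T ψ)
      have e2 := pyth (Q j) (hs j) (hid j) ψ
      have e3 := pyth T h1 h2 (ψ - Q j ψ)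
      have e4 := h j
      rw [map_sub, h3] at e3
      have := sq_nonneg ‖ψ - Q j ψ - (T ψ - Q j (T ψ))‖
      rw [hψ] at e2
      linarith

lemma one_sub_prod_le {ι : Type*} [DecidableEq ι] (S : Finset ι) (x : ι → ℝ) (h0 : ∀ i, 0 ≤ x i)
    (h1 : ∀ i, x i ≤ 1) : 1 - ∏ i ∈ S, x i ≤ ∑ i ∈ S, (1 - x i) := by
  induction S using Finset.induction_on with
  | empty => simp
  | insert j S hj ih =>
    rw [Finset.prod_insert hj, Finset.sum_insert hj]
    have p1 : ∏ i ∈ S, x i ≤ 1 := Finset.prod_le_one (fun i _ => h0 i) (fun i _ => h1 i)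
    nlinarith [h0 j, h1 j]

section
attribute [local instance] Matrix.frobeniusNormedAddCommGroup

/-- The marginal of a pure state has Frobenius norm at most one. -/
lemma norm_vecM_mul_le {ι κ : Type*} [Fintype ι] [Fintype κ] (M : Matrix ι κ ℂ)
    (hM : ∑ a, ∑ q, ‖M a q‖ ^ 2 = 1) : ‖vecM (M * Mᴴ)‖ ≤ 1 := by
  have h1 : ‖vecM (M * Mᴴ)‖ = ‖M * Mᴴ‖ := by
    rw [Matrix.frobenius_norm_def, vecM, EuclideanSpace.norm_eq, Real.sqrt_eq_rpow,
      Fintype.sum_prod_type]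
    norm_num
  have h2 : ‖M‖ = 1 := by
    rw [Matrix.frobenius_norm_def]
    have : ∑ a, ∑ q, ‖M a q‖ ^ (2:ℝ) = 1 := by simpa using hM
    rw [this]; simp
  rw [h1]
  refine (Matrix.frobenius_norm_mul _ _).trans ?_
  rw [Matrix.frobenius_norm_conjTranspose, h2]; norm_num
end

/-- Averaging: some column of `N`, normalized, has large expectation. -/
lemma exists_unit {ι κ : Type*} [Fintype ι] [Fintype κ] (R : Matrix ι ι ℂ) (N : Matrix ι κ ℂ)
    (hN : ∑ a, ∑ q, ‖N a q‖ ^ 2 = 1) (t : ℝ) (h : t ≤ ((R * (N * Nᴴ)).trace).re) :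
    ∃ χ : ι → ℂ, ‖toE χ‖ = 1 ∧ t ≤ (inner ℂ (vecM (outer χ)) (vecM R)).re := by
  by_contra hcon
  push Not at hcon
  have hq : ∀ x : ι → ℂ, x ≠ 0 → (inner ℂ (vecM (outer x)) (vecM R)).re < t * ‖toE x‖ ^ 2 := by
    intro x hx
    have hn : 0 < ‖toE x‖ := by
      rw [norm_pos_iff]; intro h0; apply hx; simpa using h0
    have h1 := hcon (fun i => ((‖toE x‖⁻¹ : ℝ) : ℂ) * x i) (by
      have : toE (fun i => ((‖toE x‖⁻¹ : ℝ) : ℂ) * x i) = ((‖toE x‖⁻¹ : ℝ) : ℂ) • toE x := by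
        ext i; simp
      rw [this, norm_smul, Complex.norm_real, Real.norm_of_nonneg (by positivity)]
      field_simp)
    have h2 : vecM (outer fun i => ((‖toE x‖⁻¹ : ℝ) : ℂ) * x i)
        = ((‖toE x‖⁻¹ ^ 2 : ℝ) : ℂ) • vecM (outer x) := by
      ext p
      simp [vecM, outer, Matrix.vecMulVec_apply]
      ring
    rw [h2, inner_smul_left, Complex.conj_ofReal, Complex.re_ofReal_mul] at h1
    rw [inv_pow, inv_mul_lt_iff₀ (by positivity)] at h1
    linarith
  have hsum : ((R * (N * Nᴴ)).trace).re
      = ∑ q, (inner ℂ (vecM (outer fun a => N a q)) (vecM R)).re := by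
    rw [← Complex.re_sum]
    congr 1
    simp only [inner_vecM, Matrix.trace, Matrix.diag, Matrix.mul_apply, outer,
      Matrix.vecMulVec_apply, Finset.mul_sum]
    rw [Finset.sum_comm (s := (Finset.univ : Finset κ))]
    refine Finset.sum_congr rfl fun a _ => ?_
    rw [Finset.sum_comm (s := (Finset.univ : Finset κ))]
    refine Finset.sum_congr rfl fun b _ => Finset.sum_congr rfl fun q _ => ?_
    simp
    ring
  have hcol : ∑ q, ‖toE fun a => N a q‖ ^ 2 = 1 := by
    simp only [norm_toE_sq]
    rw [Finset.sum_comm]; exact hN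
  have hex : ∃ q, (fun a => N a q) ≠ 0 := by
    by_contra hh
    push Not at hh
    simp [hh] at hcol
  obtain ⟨q0, hq0⟩ := hex
  have : ∑ q, (inner ℂ (vecM (outer fun a => N a q)) (vecM R)).re
      < ∑ q, t * ‖toE fun a => N a q‖ ^ 2 := by
    refine Finset.sum_lt_sum (fun q _ => ?_) ⟨q0, Finset.mem_univ _, hq _ hq0⟩
    by_cases h0 : (fun a => N a q) = 0
    · rw [h0]
      simp [inner_vecM, outer]
    · exact (hq _ h0).le
  rw [← Finset.mul_sum, hcol, ← hsum] at this
  linarith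

/-- Insert `a` at position `i`. -/
def insAt {k d m : ℕ} (i : Fin k) (a : Fin d) (q : ({j // j ≠ i} → Fin d) × Fin m) :
    (Fin k → Fin d) × Fin m := ((Equiv.funSplitAt i (Fin d)).symm (a, q.1), q.2)

lemma sum_insAt {k d m : ℕ} {R : Type*} [AddCommMonoid R] (i : Fin k)
    (F : (Fin k → Fin d) × Fin m → R) : ∑ p, F p = ∑ a, ∑ q, F (insAt i a q) := by
  rw [Fintype.sum_prod_type, ← (Equiv.funSplitAt i (Fin d)).symm.sum_comp, Fintype.sum_prod_type]
  refine Finset.sum_congr rfl fun a _ => ?_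
  rw [Fintype.sum_prod_type]
  rfl

lemma insAt_apply {k d m : ℕ} (i : Fin k) (a : Fin d) (q : ({j // j ≠ i} → Fin d) × Fin m) :
    (insAt i a q).1 i = a := by
  simp [insAt, Equiv.funSplitAt, Equiv.piSplitAt]

lemma update_insAt {k d m : ℕ} (i : Fin k) (a b : Fin d) (q : ({j // j ≠ i} → Fin d) × Fin m) :
    (Function.update (insAt i a q).1 i b, (insAt i a q).2) = insAt i b q := by
  refine Prod.ext ?_ rfl
  funext j
  by_cases h : j = i
  · subst h
    rw [insAt_apply]
    exact Function.update_self ..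
  · simp [insAt, Equiv.funSplitAt, Equiv.piSplitAt, h]

/-- `ψ` reshaped as a matrix with rows indexed by the `i`-th factor. -/
def resh {k d m : ℕ} (ψ : (Fin k → Fin d) × Fin m → ℂ) (i : Fin k) :
    Matrix (Fin d) (({j // j ≠ i} → Fin d) × Fin m) ℂ := Matrix.of fun a q => ψ (insAt i a q)

lemma marginal_eq {k d m : ℕ} (ψ : (Fin k → Fin d) × Fin m → ℂ) (i : Fin k) :
    marginalM (outer ψ) i = resh ψ i * (resh ψ i)ᴴ := by
  ext a b
  have h1 : marginalM (outer ψ) i a b = ∑ p : (Fin k → Fin d) × Fin m,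
      if p.1 i = a then outer ψ p (Function.update p.1 i b, p.2) else 0 := by
    rw [Fintype.sum_prod_type]; rfl
  rw [h1, sum_insAt i]
  simp only [insAt_apply, update_insAt]
  rw [Finset.sum_eq_single a (by intro c _ hc; simp [hc]) (by simp)]
  simp [Matrix.mul_apply, resh, outer, Matrix.vecMulVec_apply]

lemma resh_norm {k d m : ℕ} (ψ : (Fin k → Fin d) × Fin m → ℂ) (i : Fin k) (h : ‖toE ψ‖ = 1) :
    ∑ a, ∑ q, ‖resh ψ i a q‖ ^ 2 = 1 := by
  have h1 := norm_toE_sq ψ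
  rw [sum_insAt i, h] at h1
  simpa [resh] using h1.symm

/-- The projection onto `χ` in the `i`-th factor. -/
noncomputable def proj {k d m : ℕ} (i : Fin k) (χ : Fin d → ℂ) :
    EuclideanSpace ℂ ((Fin k → Fin d) × Fin m) →ₗ[ℂ] EuclideanSpace ℂ ((Fin k → Fin d) × Fin m) where
  toFun x := toE fun p => χ (p.1 i) * ∑ a, star (χ a) * x (Function.update p.1 i a, p.2)
  map_add' x y := by
    ext p
    simp [mul_add, Finset.sum_add_distrib]
  map_smul' c x := by
    ext p
    simp only [PiLp.smul_apply, smul_eq_mul, RingHom.id_apply, Finset.mul_sum]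
    refine Finset.sum_congr rfl fun a _ => ?_
    ring

lemma proj_apply {k d m : ℕ} (i : Fin k) (χ : Fin d → ℂ)
    (x : EuclideanSpace ℂ ((Fin k → Fin d) × Fin m)) (p : (Fin k → Fin d) × Fin m) :
    proj i χ x p = χ (p.1 i) * ∑ a, star (χ a) * x (Function.update p.1 i a, p.2) := rfl

lemma inner_eq_sum {ι : Type*} [Fintype ι] (x y : EuclideanSpace ℂ ι) :
    inner ℂ x y = ∑ i, star (x i) * y i := inner_toE x.ofLp y.ofLp

lemma unit_sum {ι : Type*} [Fintype ι] (x : ι → ℂ) (h : ‖toE x‖ = 1) :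
    ∑ a, star (x a) * x a = 1 := (unit_iff x).2 h

lemma proj_symm {k d m : ℕ} (i : Fin k) (χ : Fin d → ℂ) :
    (proj (m := m) i χ).IsSymmetric := by
  intro x y
  rw [inner_eq_sum, inner_eq_sum, sum_insAt i, sum_insAt i]
  simp only [proj_apply, insAt_apply, update_insAt, star_mul', star_sum, Finset.mul_sum,
    Finset.sum_mul, star_star]
  rw [Finset.sum_comm]
  conv_rhs => rw [Finset.sum_comm]
  refine Finset.sum_congr rfl fun q _ => ?_
  rw [Finset.sum_comm]
  refine Finset.sum_congr rfl fun a _ => Finset.sum_congr rfl fun b _ => ?_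
  ring

lemma proj_idem {k d m : ℕ} (i : Fin k) (χ : Fin d → ℂ) (h : ‖toE χ‖ = 1)
    (x : EuclideanSpace ℂ ((Fin k → Fin d) × Fin m)) : proj i χ (proj i χ x) = proj i χ x := by
  ext p
  rw [proj_apply]
  simp only [proj_apply, Function.update_self, Function.update_idem, ← mul_assoc]
  rw [← Finset.sum_mul, unit_sum χ h, one_mul]

lemma proj_comm {k d m : ℕ} (χ : Fin k → Fin d → ℂ) (i j : Fin k)
    (x : EuclideanSpace ℂ ((Fin k → Fin d) × Fin m)) :
    proj i (χ i) (proj j (χ j) x) = proj j (χ j) (proj i (χ i) x) := by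
  by_cases hij : i = j
  · subst hij; rfl
  ext p
  simp only [proj_apply, Function.update_of_ne hij, Function.update_of_ne (Ne.symm hij),
    Finset.mul_sum]
  rw [Finset.sum_comm]
  refine Finset.sum_congr rfl fun a _ => Finset.sum_congr rfl fun b _ => ?_
  rw [Function.update_comm hij]
  ring

lemma proj_norm {k d m : ℕ} (ψ : (Fin k → Fin d) × Fin m → ℂ) (i : Fin k) (χ : Fin d → ℂ)
    (h : ‖toE χ‖ = 1) :
    ‖proj i χ (toE ψ)‖ ^ 2 = (inner ℂ (vecM (outer χ)) (vecM (marginalM (outer ψ) i))).re := by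
  have h1 : inner ℂ (proj i χ (toE ψ)) (proj i χ (toE ψ))
      = inner ℂ (vecM (outer χ)) (vecM (marginalM (outer ψ) i)) := by
    rw [← proj_symm, proj_idem i χ h, proj_symm, inner_vecM, marginal_eq, inner_eq_sum, sum_insAt i]
    simp only [proj_apply, insAt_apply, update_insAt, Matrix.mul_apply, Finset.mul_sum, outer,
      Matrix.vecMulVec_apply, resh, Matrix.conjTranspose_apply, Matrix.of_apply]
    rw [Finset.sum_comm (s := (Finset.univ : Finset (Fin d))) (t := (Finset.univ : Finset (Fin d)))]
    refine Finset.sum_congr rfl fun a _ => ?_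
    rw [Finset.sum_comm]
    refine Finset.sum_congr rfl fun b _ => Finset.sum_congr rfl fun q _ => ?_
    simp
    ring
  rw [← h1, inner_self_eq_norm_sq_to_K]
  norm_cast

/-- A vector fixed by all projections is a product vector. -/
lemma fixed_prod {k d m : ℕ} (χ : Fin k → Fin d → ℂ) (hχ : ∀ i, ‖toE (χ i)‖ = 1)
    (u : EuclideanSpace ℂ ((Fin k → Fin d) × Fin m)) (hu : ∀ i, proj i (χ i) u = u) :
    ∃ w : Fin m → ℂ, u = toE (prodVec χ w) := by
  have hex : ∀ i, ∃ a, χ i a ≠ 0 := by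
    intro i
    by_contra hh
    push Not at hh
    have h0 : χ i = 0 := funext hh
    have := hχ i
    rw [h0] at this
    simp at this
  choose b hb using hex
  have step : ∀ i (f : Fin k → Fin d) y,
      u (f, y) * χ i (b i) = χ i (f i) * u (Function.update f i (b i), y) := by
    intro i f y
    conv_lhs => rw [← hu i]
    conv_rhs => rw [← hu i]
    simp only [proj_apply, Function.update_self, Function.update_idem]
    ring
  have ind : ∀ (S : Finset (Fin k)) (f : Fin k → Fin d) y,
      u (f, y) * ∏ i ∈ S, χ i (b i) = (∏ i ∈ S, χ i (f i)) * u (S.piecewise b f, y) := by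
    intro S
    induction S using Finset.induction_on with
    | empty => intro f y; simp
    | insert j S hj ih =>
      intro f y
      rw [Finset.prod_insert hj, Finset.prod_insert hj, Finset.piecewise_insert]
      have e := step j (S.piecewise b f) y
      rw [Finset.piecewise_eq_of_notMem _ _ _ hj] at e
      linear_combination χ j (b j) * ih f y + (∏ i ∈ S, χ i (f i)) * e
  have hC : ∏ i, χ i (b i) ≠ 0 := Finset.prod_ne_zero_iff.2 fun i _ => hb i
  refine ⟨fun y => u (b, y) / ∏ i, χ i (b i), ?_⟩
  ext ⟨f, y⟩
  have e := ind Finset.univ f y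
  rw [Finset.piecewise_univ] at e
  simp only [prodVec]
  field_simp
  exact e

lemma inner_prod {k d : ℕ} (χ η : Fin k → Fin d → ℂ) :
    inner ℂ (toE fun f : Fin k → Fin d => ∏ i, χ i (f i)) (toE fun f => ∏ i, η i (f i))
      = ∏ i, inner ℂ (toE (χ i)) (toE (η i)) := by
  simp only [inner_toE]
  rw [Finset.prod_univ_sum]
  simp [Finset.prod_mul_distrib]

lemma norm_prod_unit {k d : ℕ} (χ : Fin k → Fin d → ℂ) (hχ : ∀ i, ‖toE (χ i)‖ = 1) :
    ‖toE fun f : Fin k → Fin d => ∏ i, χ i (f i)‖ = 1 := by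
  rw [← unit_iff]
  have := inner_prod χ χ
  rw [inner_toE] at this
  refine Eq.trans this ?_
  refine Finset.prod_eq_one fun i _ => ?_
  rw [inner_self_eq_norm_sq_to_K, hχ]; simp

lemma norm_prodVec {k d m : ℕ} (χ : Fin k → Fin d → ℂ) (hχ : ∀ i, ‖toE (χ i)‖ = 1)
    (w : Fin m → ℂ) : ‖toE (prodVec χ w)‖ = ‖toE w‖ := by
  have h1 : ‖toE (prodVec χ w)‖ ^ 2 = ‖toE w‖ ^ 2 := by
    have h2 := norm_toE_sq fun f : Fin k → Fin d => ∏ i, χ i (f i)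
    rw [norm_prod_unit χ hχ] at h2
    rw [norm_toE_sq, norm_toE_sq, Fintype.sum_prod_type]
    simp only [prodVec, norm_mul, mul_pow, ← Finset.mul_sum]
    rw [← Finset.sum_mul, ← h2]; ring
  exact (pow_left_inj₀ (norm_nonneg _) (norm_nonneg _) two_ne_zero).1 h1

lemma trK_prod {k d m : ℕ} (χ : Fin k → Fin d → ℂ) (w : Fin m → ℂ) (hw : ‖toE w‖ = 1) :
    trK (outer (prodVec χ w)) = outer (fun f : Fin k → Fin d => ∏ i, χ i (f i)) := by
  ext f g
  simp only [trK, Matrix.of_apply, outer, Matrix.vecMulVec_apply, prodVec, Pi.star_apply, star_mul']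
  have h := unit_sum w hw
  calc _ = ∑ y, ((∏ i, χ i (f i)) * star (∏ i, χ i (g i))) * (star (w y) * w y) := by
        refine Finset.sum_congr rfl fun y _ => ?_
        ring
    _ = _ := by rw [← Finset.mul_sum, h, mul_one]

lemma exists_close {k d m : ℕ} (ψ : (Fin k → Fin d) × Fin m → ℂ) (hψ : ‖toE ψ‖ = 1)
    (ε : Fin k → ℝ) (χ : Fin k → Fin d → ℂ) (hχ : ∀ i, ‖toE (χ i)‖ = 1)
    (h : ∀ i, 1 - ε i ≤ (inner ℂ (vecM (outer (χ i))) (vecM (marginalM (outer ψ) i))).re) :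
    ∃ w : Fin m → ℂ, ‖toE w‖ = 1 ∧
      frobNorm (outer ψ - outer (prodVec χ w)) ^ 2 ≤ 2 * ∑ i, ε i := by
  obtain ⟨T, h1, h2, -, h4, h5⟩ := union_bound (fun i => proj (m := m) i (χ i))
    (fun i => proj_symm i _) (fun i => proj_idem i _ (hχ i)) (fun i j => proj_comm χ i j)
    (toE ψ) hψ ε (fun i => by rw [proj_norm _ _ _ (hχ i)]; exact h i) Finset.univ
  obtain ⟨w, hw⟩ := fixed_prod χ hχ (T (toE ψ)) (fun i => h4 i (Finset.mem_univ _) _)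
  suffices hs : ∃ w' : Fin m → ℂ, ‖toE w'‖ = 1 ∧
      ‖T (toE ψ)‖ ^ 2 ≤ ‖inner ℂ (toE ψ) (toE (prodVec χ w'))‖ ^ 2 by
    obtain ⟨w', hw', hh⟩ := hs
    refine ⟨w', hw', ?_⟩
    rw [frob_outer_sub _ _ hψ (by rw [norm_prodVec χ hχ, hw'])]
    linarith
  by_cases h0 : toE w = 0
  · have hm : Nonempty (Fin m) := by
      by_contra hm
      rw [not_nonempty_iff] at hm
      have := norm_toE_sq ψ
      rw [hψ] at this
      simp at this
    obtain ⟨y⟩ := hm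
    refine ⟨Pi.single y 1, by simpa using EuclideanSpace.norm_single (𝕜 := ℂ) y (1 : ℂ), ?_⟩
    rw [hw, norm_prodVec χ hχ, h0]
    simp
  · have hn : 0 < ‖toE w‖ := norm_pos_iff.2 h0
    refine ⟨fun y => ((‖toE w‖⁻¹ : ℝ) : ℂ) * w y, ?_, ?_⟩
    · have : toE (fun i => ((‖toE w‖⁻¹ : ℝ) : ℂ) * w i) = ((‖toE w‖⁻¹ : ℝ) : ℂ) • toE w := by
        ext i; simp
      rw [this, norm_smul, Complex.norm_real, Real.norm_of_nonneg (by positivity)]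
      field_simp
    · have e : toE (prodVec χ fun y => ((‖toE w‖⁻¹ : ℝ) : ℂ) * w y)
          = ((‖toE w‖⁻¹ : ℝ) : ℂ) • T (toE ψ) := by
        rw [hw]
        ext p
        simp [prodVec]
        ring
      have hT : ‖T (toE ψ)‖ = ‖toE w‖ := by rw [hw, norm_prodVec χ hχ]
      have e2 : inner ℂ (toE ψ) (T (toE ψ)) = ((‖toE w‖ ^ 2 : ℝ) : ℂ) := by
        rw [← h2, ← h1, inner_self_eq_norm_sq_to_K, hT]
        push_cast; rfl
      rw [e, inner_smul_right, e2, hT, norm_mul, Complex.norm_real, Complex.norm_real,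
        Real.norm_of_nonneg (by positivity), Real.norm_of_nonneg (by positivity)]
      apply le_of_eq
      field_simp

lemma overlap_bound {d : ℕ} {κ κ' : Type*} [Fintype κ] [Fintype κ'] (M : Matrix (Fin d) κ ℂ)
    (N : Matrix (Fin d) κ' ℂ)
    (hM : ∑ a, ∑ q, ‖M a q‖ ^ 2 = 1) (hN : ∑ a, ∑ q, ‖N a q‖ ^ 2 = 1) (e : ℝ)
    (he : 0 ≤ e) (h : 1 - e ≤ ((M * Mᴴ * (N * Nᴴ)).trace).re) (x y : Fin d → ℂ)
    (hx : ‖toE x‖ = 1) (hy : ‖toE y‖ = 1)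
    (h1 : 1 - e ≤ (inner ℂ (vecM (outer x)) (vecM (M * Mᴴ))).re)
    (h2 : 1 - e ≤ (inner ℂ (vecM (outer y)) (vecM (N * Nᴴ))).re) :
    1 - ‖inner ℂ (toE x) (toE y)‖ ^ 2 ≤ 9 * e := by
  have hP := norm_vecM_mul_le M hM
  have hR := norm_vecM_mul_le N hN
  have htr : (M * Mᴴ * (N * Nᴴ)).trace = inner ℂ (vecM (M * Mᴴ)) (vecM (N * Nᴴ)) := by
    rw [inner_vecM]
    have hh : ∀ a b, star ((M * Mᴴ) a b) = (M * Mᴴ) b a := fun a b => by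
      rw [← Matrix.conjTranspose_apply, Matrix.conjTranspose_mul, Matrix.conjTranspose_conjTranspose]
    simp only [hh]
    rw [Finset.sum_comm]
    simp only [Matrix.trace, Matrix.diag]
    refine Finset.sum_congr rfl fun a _ => ?_
    rw [Matrix.mul_apply]
  rw [htr] at h
  have key : ∀ u v : EuclideanSpace ℂ (Fin d × Fin d), ‖u‖ ≤ 1 → ‖v‖ ≤ 1 →
      1 - e ≤ (inner ℂ u v).re → ‖u - v‖ ≤ Real.sqrt (2 * e) := by
    intro u v hu hv huv
    apply Real.le_sqrt_of_sq_le
    rw [@norm_sub_sq ℂ]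
    have := norm_nonneg u
    have := norm_nonneg v
    simp only [RCLike.re_to_complex]
    nlinarith
  have hnx : ‖vecM (outer x)‖ ≤ 1 := by nlinarith [norm_vecM_outer x hx, norm_nonneg (vecM (outer x))]
  have hny : ‖vecM (outer y)‖ ≤ 1 := by nlinarith [norm_vecM_outer y hy, norm_nonneg (vecM (outer y))]
  have k1 := key _ _ hnx hP h1
  have k2 := key _ _ hP hR h
  have k3 := key _ _ hny hR h2
  have tri : ‖vecM (outer x) - vecM (outer y)‖ ≤ 3 * Real.sqrt (2 * e) := by
    have t1 := norm_sub_le_norm_sub_add_norm_sub (vecM (outer x)) (vecM (M * Mᴴ)) (vecM (outer y))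
    have t2 := norm_sub_le_norm_sub_add_norm_sub (vecM (M * Mᴴ)) (vecM (N * Nᴴ)) (vecM (outer y))
    rw [norm_sub_rev (vecM (N * Nᴴ))] at t2
    linarith
  have fin := frob_outer_sub x y hx hy
  rw [frobNorm_eq, vecM_sub] at fin
  have sq : (3 * Real.sqrt (2 * e)) ^ 2 = 18 * e := by
    rw [mul_pow, Real.sq_sqrt (by positivity)]; ring
  have := pow_le_pow_left₀ (norm_nonneg _) tri 2
  linarith

lemma le_of_sq_le_sq_aux {a b : ℝ} (h : a ^ 2 ≤ b ^ 2) (hb : 0 ≤ b) : a ≤ b :=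
  (le_abs_self a).trans (abs_le_of_sq_le_sq h hb)

/-- Pure states on `H^{⊗k} ⊗ K` whose marginals have pairwise overlap `Tr(ρᵢσᵢ) ≥ 1 − εᵢ`
are `2√(kε)`-close to fully separable pure states `ρ̃, σ̃` whose `H^{⊗k}` reductions are
`6√(kε)`-close, with `ε = (1/k)Σᵢεᵢ`. -/
theorem close_to_separable {k d m : ℕ} (hk : 0 < k)
    (ψ φ : ((Fin k → Fin d) × Fin m) → ℂ)
    (hψ : star ψ ⬝ᵥ ψ = 1) (hφ : star φ ⬝ᵥ φ = 1)
    (ε : Fin k → ℝ) (hε : ∀ i, ε i ∈ Set.Icc (0 : ℝ) 1)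
    (h : ∀ i, 1 - ε i ≤ ((marginalM (outer ψ) i * marginalM (outer φ) i).trace).re) :
    ∃ (χ φc : Fin k → Fin d → ℂ) (ψ' φ' : Fin m → ℂ),
      (∀ i, star (χ i) ⬝ᵥ χ i = 1) ∧ (∀ i, star (φc i) ⬝ᵥ φc i = 1) ∧
      star ψ' ⬝ᵥ ψ' = 1 ∧ star φ' ⬝ᵥ φ' = 1 ∧
      frobNorm (outer ψ - outer (prodVec χ ψ')) ≤ 2 * Real.sqrt (k * ((∑ i, ε i) / k)) ∧
      frobNorm (outer φ - outer (prodVec φc φ')) ≤ 2 * Real.sqrt (k * ((∑ i, ε i) / k)) ∧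
      frobNorm (trK (outer (prodVec χ ψ')) - trK (outer (prodVec φc φ'))) ≤
        6 * Real.sqrt (k * ((∑ i, ε i) / k)) := by
  have hS : (k : ℝ) * ((∑ i, ε i) / k) = ∑ i, ε i := by
    have : (k : ℝ) ≠ 0 := by exact_mod_cast hk.ne'
    field_simp
  rw [hS]
  have hS0 : 0 ≤ ∑ i, ε i := Finset.sum_nonneg fun i _ => (hε i).1
  rw [unit_iff] at hψ hφ
  have hx : ∀ i, ∃ x : Fin d → ℂ, ‖toE x‖ = 1 ∧
      1 - ε i ≤ (inner ℂ (vecM (outer x)) (vecM (marginalM (outer ψ) i))).re := by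
    intro i
    refine exists_unit _ (resh φ i) (resh_norm φ i hφ) _ ?_
    rw [← marginal_eq]
    exact h i
  have hy : ∀ i, ∃ x : Fin d → ℂ, ‖toE x‖ = 1 ∧
      1 - ε i ≤ (inner ℂ (vecM (outer x)) (vecM (marginalM (outer φ) i))).re := by
    intro i
    refine exists_unit _ (resh ψ i) (resh_norm ψ i hψ) _ ?_
    rw [← marginal_eq, Matrix.trace_mul_comm]
    exact h i
  choose χ hχ hχ2 using hx
  choose η hη hη2 using hy
  obtain ⟨w, hw, hw2⟩ := exists_close ψ hψ ε χ hχ hχ2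
  obtain ⟨v, hv, hv2⟩ := exists_close φ hφ ε η hη hη2
  have hsq := Real.sq_sqrt hS0
  have hsn := Real.sqrt_nonneg (∑ i, ε i)
  refine ⟨χ, η, w, v, fun i => (unit_iff _).2 (hχ i), fun i => (unit_iff _).2 (hη i),
    (unit_iff _).2 hw, (unit_iff _).2 hv, ?_, ?_, ?_⟩
  · refine le_of_sq_le_sq_aux ?_ (by positivity)
    rw [mul_pow, hsq]; linarith
  · refine le_of_sq_le_sq_aux ?_ (by positivity)
    rw [mul_pow, hsq]; linarith
  · refine le_of_sq_le_sq_aux ?_ (by positivity)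
    rw [mul_pow, hsq, trK_prod χ w hw, trK_prod η v hv,
      frob_outer_sub _ _ (norm_prod_unit χ hχ) (norm_prod_unit η hη), inner_prod, norm_prod,
      ← Finset.prod_pow]
    have b1 := one_sub_prod_le Finset.univ (fun i => ‖inner ℂ (toE (χ i)) (toE (η i))‖ ^ 2)
      (fun i => by positivity) (fun i => by
        have := norm_inner_le_norm (𝕜 := ℂ) (toE (χ i)) (toE (η i))
        rw [hχ, hη] at this
        exact pow_le_one₀ (norm_nonneg _) (by linarith))
    have b2 : ∑ i, (1 - ‖inner ℂ (toE (χ i)) (toE (η i))‖ ^ 2) ≤ ∑ i, 9 * ε i := by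
      refine Finset.sum_le_sum fun i _ => ?_
      refine overlap_bound (resh ψ i) (resh φ i) (resh_norm ψ i hψ) (resh_norm φ i hφ) (ε i)
        (hε i).1 ?_ _ _ (hχ i) (hη i) ?_ ?_
      · rw [← marginal_eq, ← marginal_eq]; exact h i
      · rw [← marginal_eq]; exact hχ2 i
      · rw [← marginal_eq]; exact hη2 i
    rw [← Finset.mul_sum] at b2
    linarith
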